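/- Let N ≥ 2, γ > 1, K > 0 and β > 0. If (ρ, u) is a global classical solution with compact support of the N-dimensional Euler-Poisson equations with repulsive forces and frictional damping β, with positive total mass M = ∫ρ dx and supports contained in a fixed bounded set Ω of positive finite volume |Ω|, then liminf_{t→∞} R(t)/t^{1/2} ≥ [2 N K M^{γ−1} / (β |Ω|^{γ−1})]^{1/2}, where R(t) = max{|x| : x ∈ supp ρ(t,·)}. (This follows from the differential inequality Ḧ(t) + β Ḣ(t) ≥ 2NK|Ω|^{1−γ}M^γ for the second inertia function H(t) = ∫ρ|x|² dx together with H(t) ≤ R(t)²M.) -/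

import Mathlib

open MeasureTheory Filter Real

set_option linter.unusedSectionVars false

section EPgeneral
variable {E : Type*} [NormedAddCommGroup E] [InnerProductSpace ℝ E] [FiniteDimensional ℝ E]
  [MeasurableSpace E] [BorelSpace E]

lemma ep_hcs {g : E → ℝ} {r : ℝ} (h : ∀ x, x ∉ Metric.closedBall (0:E) r → g x = 0) :
    HasCompactSupport g :=
  HasCompactSupport.intro (isCompact_closedBall 0 r) h

lemma ep_ibp {f g : E → ℝ} (hf : ContDiff ℝ 1 f) (hg : ContDiff ℝ 1 g)
    (hgs : HasCompactSupport g) (v : E) :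
    Integrable (fun x => f x * fderiv ℝ g x v) ∧
    ∫ x, f x * fderiv ℝ g x v = - ∫ x, fderiv ℝ f x v * g x := by
  have cf : Continuous (fun x => fderiv ℝ f x v) := (hf.continuous_fderiv (by simp)).clm_apply continuous_const
  have cg : Continuous (fun x => fderiv ℝ g x v) := (hg.continuous_fderiv (by simp)).clm_apply continuous_const
  have h2 : Integrable (fun x => f x * fderiv ℝ g x v) :=
    (hf.continuous.mul cg).integrable_of_hasCompactSupport (hgs.fderiv_apply (𝕜 := ℝ) v).mul_left
  refine ⟨h2, ?_⟩
  apply integral_mul_fderiv_eq_neg_fderiv_mul_of_integrable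
  · exact (cf.mul hg.continuous).integrable_of_hasCompactSupport hgs.mul_left
  · exact h2
  · exact (hf.continuous.mul hg.continuous).integrable_of_hasCompactSupport hgs.mul_left
  · intro x _; exact hf.differentiable (by simp) x
  · intro x _; exact hg.differentiable (by simp) x

lemma ep_time {F : ℝ → E → ℝ} {r : ℝ}
    (hF : ContDiffOn ℝ 1 (fun p : ℝ × E => F p.1 p.2) (Set.Ioi (0:ℝ) ×ˢ Set.univ))
    (hs : ∀ t, 0 < t → ∀ x, x ∉ Metric.closedBall (0:E) r → F t x = 0) {t : ℝ} (ht : 0 < t) :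
    HasDerivAt (fun s => ∫ x, F s x) (∫ x, deriv (fun s => F s x) t) t := by
  have hop : IsOpen (Set.Ioi (0:ℝ) ×ˢ (Set.univ : Set E)) := isOpen_Ioi.prod isOpen_univ
  have hdiff : ∀ s, 0 < s → ∀ x, HasFDerivAt (fun p : ℝ × E => F p.1 p.2)
      (fderiv ℝ (fun p : ℝ × E => F p.1 p.2) (s, x)) (s, x) := by
    intro s hs0 x
    exact ((hF.differentiableOn (by simp)).differentiableAt
      (hop.mem_nhds (show (s, x) ∈ Set.Ioi (0:ℝ) ×ˢ (Set.univ : Set E) from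
        ⟨hs0, Set.mem_univ _⟩))).hasFDerivAt
  have hd : ∀ s, 0 < s → ∀ x, HasDerivAt (fun s => F s x)
      (fderiv ℝ (fun p : ℝ × E => F p.1 p.2) (s, x) (1, 0)) s := by
    intro s hs0 x
    have h1 : HasDerivAt (fun s : ℝ => (s, x)) ((1:ℝ), (0:E)) s :=
      (hasDerivAt_id s).prodMk (hasDerivAt_const s x)
    exact (hdiff s hs0 x).comp_hasDerivAt s h1
  have hcont : ContinuousOn (fun p : ℝ × E => fderiv ℝ (fun p : ℝ × E => F p.1 p.2) p (1, 0))
      (Set.Ioi (0:ℝ) ×ˢ Set.univ) :=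
    (hF.continuousOn_fderiv_of_isOpen hop (by simp)).clm_apply continuousOn_const
  have hcF : ∀ s, 0 < s → Continuous (F s) := by
    intro s hs0
    have : ContinuousOn (fun p : ℝ × E => F p.1 p.2) (Set.Ioi (0:ℝ) ×ˢ Set.univ) := hF.continuousOn
    exact this.comp_continuous (f := fun x : E => (s, x)) (by fun_prop) (fun x => ⟨hs0, Set.mem_univ _⟩)
  have hK : IsCompact (Set.Icc (t/2) (2*t) ×ˢ Metric.closedBall (0:E) r) :=
    isCompact_Icc.prod (isCompact_closedBall 0 r)
  obtain ⟨C, hC⟩ := hK.exists_bound_of_continuousOn (hcont.mono (by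
    rintro ⟨s, x⟩ ⟨h1, h2⟩
    refine ⟨?_, Set.mem_univ _⟩
    have := h1.1
    simp only [Set.mem_Ioi] at this ⊢
    linarith))
  have hzero : ∀ s, 0 < s → ∀ x, x ∉ Metric.closedBall (0:E) r →
      deriv (fun s => F s x) s = 0 := by
    intro s hs0 x hx
    have : (fun s => F s x) =ᶠ[nhds s] fun _ => 0 := by
      filter_upwards [Ioi_mem_nhds hs0] with s' hs' using hs s' hs' x hx
    rw [this.deriv_eq]; simp
  refine (hasDerivAt_integral_of_dominated_loc_of_deriv_le (s := Set.Icc (t/2) (2*t))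
    (bound := (Metric.closedBall (0:E) r).indicator fun _ => C)
    (F' := fun s x => deriv (fun s => F s x) s)
    (Icc_mem_nhds (by linarith) (by linarith)) ?_ ?_ ?_ ?_ ?_ ?_).2
  · filter_upwards [Ioi_mem_nhds ht] with s hs0
    exact (hcF s hs0).aestronglyMeasurable
  · exact (hcF t ht).integrable_of_hasCompactSupport (ep_hcs (hs t ht))
  · have : (fun x => deriv (fun s => F s x) t) =
        fun x => fderiv ℝ (fun p : ℝ × E => F p.1 p.2) (t, x) (1, 0) := by
      ext x; exact (hd t ht x).deriv
    rw [this]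
    exact (hcont.comp_continuous (f := fun x : E => (t, x)) (by fun_prop)
      (fun x => ⟨ht, Set.mem_univ _⟩)).aestronglyMeasurable
  · refine ae_of_all _ fun x s hs' => ?_
    have hs0 : 0 < s := by have := hs'.1; linarith
    by_cases hx : x ∈ Metric.closedBall (0:E) r
    · rw [Set.indicator_of_mem hx, (hd s hs0 x).deriv]
      exact hC (s, x) ⟨hs', hx⟩
    · rw [Set.indicator_of_notMem hx, hzero s hs0 x hx]; simp
  · exact (integrable_indicator_iff measurableSet_closedBall).2
      (integrableOn_const (measure_closedBall_lt_top.ne) (by simp))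
  · refine ae_of_all _ fun x s hs' => ?_
    have hs0 : 0 < s := by have := hs'.1; linarith
    exact (hd s hs0 x).differentiableAt.hasDerivAt

lemma ep_locint [Nontrivial E] {g : ℝ → ℝ} (hg : ∀ R : ℝ, 
    IntegrableOn (fun y : ℝ => y ^ (Module.finrank ℝ E - 1) * g y) (Set.Ioc 0 R)) :
    LocallyIntegrable (fun x : E => g ‖x‖) := by
  rw [locallyIntegrable_iff]
  intro k hk
  obtain ⟨R, hR⟩ := hk.isBounded.subset_closedBall 0
  refine IntegrableOn.mono_set ?_ hR
  rw [← integrable_indicator_iff measurableSet_closedBall]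
  have : (Metric.closedBall (0:E) R).indicator (fun x : E => g ‖x‖) =
      fun x => (Set.Iic R).indicator g ‖x‖ := by
    ext x
    simp [Set.indicator]
  rw [this, integrable_fun_norm_addHaar]
  have h2 : (fun y : ℝ => y ^ (Module.finrank ℝ E - 1) • (Set.Iic R).indicator g y) =
      (Set.Iic R).indicator (fun y : ℝ => y ^ (Module.finrank ℝ E - 1) * g y) := by
    ext y
    by_cases hy : y ≤ R <;> simp [Set.indicator, hy]
  rw [h2, IntegrableOn, integrable_indicator_iff measurableSet_Iic, IntegrableOn,
    Measure.restrict_restrict measurableSet_Iic, Set.inter_comm]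
  exact hg R

/-- Virial identity for the potential via scaling. -/
lemma ep_virial [Nontrivial E] {G : E → ℝ} (hGm : Measurable G) (hGl : LocallyIntegrable G)
    (hGn : ∀ z, G (-z) = G z) {a b : ℝ → ℝ} {a' b' : ℝ}
    (hG : ∀ s, 0 < s → ∀ z, z ≠ 0 → G (s • z) = a s * G z + b s)
    (ha : HasDerivAt a a' 1) (ha1 : a 1 = 1) (hb : HasDerivAt b b' 1) (hb' : 0 ≤ b')
    {ρ : E → ℝ} (hρ : ContDiff ℝ 1 ρ) (hρ0 : ∀ x, 0 ≤ ρ x) {r : ℝ}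
    (hs : ∀ x, x ∉ Metric.closedBall (0:E) r → ρ x = 0)
    {Φ : E → ℝ} (hΦ : ∀ x, Φ x = ∫ y, G (x - y) * ρ y)
    (hpos : 0 ≤ a' * ∫ x, ρ x * Φ x) :
    ContDiff ℝ 1 Φ ∧ 0 ≤ ∫ x, ρ x * fderiv ℝ Φ x x := by
  have hcs := ep_hcs hs
  have hconv : ∀ {g : E → ℝ}, LocallyIntegrable g →
      ContDiff ℝ 1 (fun x => ∫ y, g (x - y) * ρ y) := by
    intro g hg
    have := hcs.contDiff_convolution_left (n := 1) (𝕜 := ℝ) (μ := volume)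
      (ContinuousLinearMap.mul ℝ ℝ) hρ hg
    have he : (fun x => ∫ y, g (x - y) * ρ y) =
        convolution ρ g (ContinuousLinearMap.mul ℝ ℝ) volume := by
      ext x
      simp [convolution, mul_comm]
    rw [he]; exact this
  have hex : ∀ {g : E → ℝ}, LocallyIntegrable g → ∀ x, Integrable (fun y => g (x - y) * ρ y) := by
    intro g hg x
    have := hcs.convolutionExists_left (𝕜 := ℝ) (μ := volume)
      (ContinuousLinearMap.mul ℝ ℝ) hρ.continuous hg x
    simpa [ConvolutionExistsAt, mul_comm] using this
  have hGl' : LocallyIntegrable (fun z => ‖G z‖) := by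
    intro x
    obtain ⟨U, hU, h⟩ := hGl x
    exact ⟨U, hU, h.norm⟩
  have hΦc : ContDiff ℝ 1 Φ := by
    have : Φ = fun x => ∫ y, G (x - y) * ρ y := funext hΦ
    rw [this]; exact hconv hGl
  refine ⟨hΦc, ?_⟩
  set h : ℝ → ℝ := fun s => ∫ x, ρ x * Φ (s • x) with hh
  have hder : HasDerivAt h (∫ x, ρ x * fderiv ℝ Φ x x) 1 := by
    have := ep_time (F := fun s x => ρ x * Φ (s • x)) (r := r) (by fun_prop)
      (by intro t _ x hx; simp [hs x hx]) (t := 1) one_pos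
    convert this using 2
    ext x
    have h1 : HasDerivAt (fun s : ℝ => s • x) ((1:ℝ) • x) 1 := (hasDerivAt_id (1:ℝ)).smul_const x
    have h2 : HasFDerivAt Φ (fderiv ℝ Φ x) ((1:ℝ) • x) := by
      rw [one_smul]; exact (hΦc.differentiable (by simp) x).hasFDerivAt
    have h3 := (h2.comp_hasDerivAt (1:ℝ) h1).const_mul (ρ x)
    rw [one_smul] at h3
    exact h3.deriv.symm
  have hsym : ∀ s, 0 < s → h s = a s * h s⁻¹ + b s * (∫ x, ρ x) ^ 2 := by
    intro s hs0
    have hint : Integrable (Function.uncurry fun x y => ρ x * (G (s • x - y) * ρ y))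
        ((volume : Measure E).prod (volume : Measure E)) := by
      have hm : Measurable (Function.uncurry fun x y => ρ x * (G (s • x - y) * ρ y)) := by
        have := hρ.continuous.measurable
        unfold Function.uncurry
        fun_prop
      rw [integrable_prod_iff hm.aestronglyMeasurable]
      constructor
      · exact ae_of_all _ fun x => (hex hGl (s • x)).const_mul (ρ x)
      · have : (fun x => ∫ y, ‖Function.uncurry (fun x y => ρ x * (G (s • x - y) * ρ y)) (x, y)‖) =
            fun x => ρ x * ((fun x => ∫ y, ‖G (x - y)‖ * ρ y) (s • x)) := by
          ext x
          simp only [Function.uncurry, norm_mul, Real.norm_of_nonneg (hρ0 _)]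
          rw [integral_const_mul]
        rw [this]
        exact (hρ.continuous.mul ((hconv hGl').continuous.comp (by fun_prop))).integrable_of_hasCompactSupport
          hcs.mul_right
    have e1 : h s = ∫ y, ∫ x, ρ x * (G (s • x - y) * ρ y) := by
      rw [← integral_integral_swap hint, hh]
      simp only [hΦ, integral_const_mul]
    have e2 : ∀ y, ∫ x, ρ x * (G (s • x - y) * ρ y) =
        a s * (ρ y * Φ (s⁻¹ • y)) + b s * (ρ y * ∫ x, ρ x) := by
      intro y
      have : (fun x => ρ x * (G (s • x - y) * ρ y)) =ᵐ[volume]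
          fun x => (a s * ρ y) * (G (s⁻¹ • y - x) * ρ x) + (b s * ρ y) * ρ x := by
        have hne : ∀ᵐ x : E, x ≠ s⁻¹ • y := by
          simp [ae_iff]
        filter_upwards [hne] with x hx
        have : s • x - y = s • (-(s⁻¹ • y - x)) := by
          rw [neg_sub, smul_sub, smul_inv_smul₀ hs0.ne']
        rw [this, hG s hs0 _ (by rw [neg_sub]; exact sub_ne_zero.2 hx), hGn]
        ring
      rw [integral_congr_ae this, integral_add ((hex hGl _).const_mul _)
        ((hρ.continuous.integrable_of_hasCompactSupport hcs).const_mul _),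
        integral_const_mul, integral_const_mul, hΦ]
      ring
    rw [e1]
    simp_rw [e2]
    have i1 : Integrable fun y => ρ y * Φ (s⁻¹ • y) :=
      (hρ.continuous.mul (hΦc.continuous.comp (by fun_prop))).integrable_of_hasCompactSupport
          hcs.mul_right
    rw [integral_add (i1.const_mul _) (((hρ.continuous.integrable_of_hasCompactSupport hcs).mul_const _).const_mul _),
      integral_const_mul, integral_const_mul, integral_mul_const]
    ring
  set D := ∫ x, ρ x * fderiv ℝ Φ x x
  have hinv : HasDerivAt (fun s : ℝ => h s⁻¹) (-D) 1 := by
    have h1 : HasDerivAt (fun s : ℝ => s⁻¹) (-1) 1 := by simpa using hasDerivAt_inv (one_ne_zero (α := ℝ))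
    have h2 : HasDerivAt h D ((1:ℝ)⁻¹) := by simpa using hder
    have h3 := h2.comp (1:ℝ) h1
    rw [mul_neg_one] at h3
    exact h3
  have hr : HasDerivAt (fun s => a s * h s⁻¹ + b s * (∫ x, ρ x) ^ 2)
      (a' * h 1⁻¹ + a 1 * (-D) + b' * (∫ x, ρ x)^2) 1 :=
    (ha.mul hinv).add (hb.mul_const _)
  have heq : h =ᶠ[nhds 1] (fun s => a s * h s⁻¹ + b s * (∫ x, ρ x) ^ 2) := by
    filter_upwards [Ioi_mem_nhds (one_pos (α := ℝ))] with s hs0 using hsym s hs0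
  have := hder.unique (hr.congr_of_eventuallyEq heq)
  have h1 : h 1⁻¹ = ∫ x, ρ x * Φ x := by simp [hh]
  rw [h1, ha1] at this
  have : 0 ≤ b' * (∫ x, ρ x)^2 := by positivity
  linarith

end EPgeneral

lemma ep_grow {f f' : ℝ → ℝ} {c T : ℝ} (hf : ∀ t, T ≤ t → HasDerivAt f (f' t) t)
    (hc : ∀ t, T ≤ t → c ≤ f' t) {t : ℝ} (ht : T ≤ t) : f T + c * (t - T) ≤ f t := by
  have := Convex.mul_sub_le_image_sub_of_le_deriv (convex_Ici T) (f := f)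
    (fun x hx => (hf x hx).continuousAt.continuousWithinAt)
    (fun x hx => (hf x (interior_subset hx)).differentiableAt.differentiableWithinAt) (C := c)
    (fun x hx => by rw [(hf x (interior_subset hx)).deriv]; exact hc x (interior_subset hx))
    T (Set.self_mem_Ici) t ht ht
  linarith

lemma ep_ode {H Q Q' : ℝ → ℝ} {β c B : ℝ} (hβ : 0 < β) (hc : 0 < c)
    (hH : ∀ t, 0 < t → HasDerivAt H (Q t) t) (hQ : ∀ t, 0 < t → HasDerivAt Q (Q' t) t)
    (hineq : ∀ t, 0 < t → c ≤ Q' t + β * Q t) (hB : ∀ t, 0 < t → H t ≤ B) : False := by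
  have h1 : ∀ t, 1 ≤ t → (Q 1 + β * H 1) + c * (t - 1) ≤ Q t + β * H t := by
    intro t ht
    exact ep_grow (f := fun t => Q t + β * H t) (f' := fun t => Q' t + β * Q t)
      (fun s hs => (hQ s (by linarith)).add ((hH s (by linarith)).const_mul β))
      (fun s hs => hineq s (by linarith)) ht
  obtain ⟨T, hT1, hT⟩ : ∃ T : ℝ, 1 ≤ T ∧ 1 + β * B - (Q 1 + β * H 1) ≤ c * (T - 1) := by
    refine ⟨1 + |1 + β * B - (Q 1 + β * H 1)| / c, ?_, ?_⟩
    · have : 0 ≤ |1 + β * B - (Q 1 + β * H 1)| / c := by positivity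
      linarith
    · rw [add_sub_cancel_left, mul_div_cancel₀ _ hc.ne']
      exact le_abs_self _
  have h2 : ∀ t, T ≤ t → 1 ≤ Q t := by
    intro t ht
    have e1 := h1 t (by linarith)
    have e2 := mul_le_mul_of_nonneg_left (hB t (by linarith)) hβ.le
    have e3 : c * (T - 1) ≤ c * (t - 1) := mul_le_mul_of_nonneg_left (by linarith) hc.le
    linarith
  have hTB : T ≤ T + (|B - H T| + 1) := by 
    have := abs_nonneg (B - H T)
    linarith
  have h3 := ep_grow (f := H) (f' := Q) (c := 1) (fun s hs => hH s (by linarith)) h2 hTB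
  have h4 := hB (T + (|B - H T| + 1)) (by linarith)
  have h5 := le_abs_self (B - H T)
  linarith

lemma ep_jensen {E : Type*} [MeasureSpace E] {ρ : E → ℝ} {γ M : ℝ} {Ω : Set E} (hγ : 1 < γ)
    (hM : 0 < M) (hΩm : MeasurableSet Ω) (hV : 0 < (volume Ω).toReal) (hρ0 : ∀ x, 0 ≤ ρ x)
    (hs : Function.support ρ ⊆ Ω) (hi : Integrable ρ) (hiγ : Integrable (fun x => ρ x ^ γ))
    (hm : ∫ x, ρ x = M) :
    (M / (volume Ω).toReal) ^ γ * (volume Ω).toReal ≤ ∫ x, ρ x ^ γ := by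
  set V := (volume Ω).toReal with hVdef
  have hfin : volume Ω ≠ ⊤ := by
    intro h; simp [hVdef, h] at hV
  set a := M / V with ha
  have ha0 : 0 < a := by positivity
  have hpt : ∀ x, a ^ γ * (1 - γ) + (a ^ γ * γ / a) * ρ x ≤ ρ x ^ γ := by
    intro x
    have h0 : 0 ≤ ρ x / a := div_nonneg (hρ0 x) ha0.le
    have h1 := one_add_mul_self_le_rpow_one_add (s := ρ x / a - 1) (by linarith) hγ.le
    rw [add_sub_cancel, Real.div_rpow (hρ0 x) ha0.le, le_div_iff₀ (by positivity)] at h1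
    calc _ = (1 + γ * (ρ x / a - 1)) * a ^ γ := by ring
      _ ≤ _ := h1
  have e1 : ∫ x, ρ x ^ γ = ∫ x in Ω, ρ x ^ γ := by
    rw [setIntegral_eq_integral_of_forall_compl_eq_zero]
    intro x hx
    have : ρ x = 0 := by by_contra h; exact hx (hs h)
    rw [this, Real.zero_rpow (by linarith)]
  have e2 : ∫ x in Ω, ρ x = M := by
    rw [setIntegral_eq_integral_of_forall_compl_eq_zero, hm]
    intro x hx
    by_contra h; exact hx (hs h)
  have ic : IntegrableOn (fun _ : E => a ^ γ * (1 - γ)) Ω :=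
    integrableOn_const hfin enorm_ne_top
  have h3 : ∫ x in Ω, (a ^ γ * (1 - γ) + (a ^ γ * γ / a) * ρ x) ≤ ∫ x in Ω, ρ x ^ γ :=
    setIntegral_mono (ic.add (hi.integrableOn.const_mul _)) hiγ.integrableOn hpt
  rw [integral_add ic (hi.integrableOn.const_mul _), setIntegral_const,
    integral_const_mul, e2] at h3
  rw [e1]
  refine le_trans (le_of_eq ?_) h3
  have : M = a * V := by rw [ha]; field_simp
  rw [this, Measure.real, ← hVdef, smul_eq_mul]
  field_simp
  ring

lemma ep_virial_euclid (N : ℕ) (hN : 2 ≤ N) {ρ Φ : EuclideanSpace ℝ (Fin N) → ℝ}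
    (hρ : ContDiff ℝ 1 ρ) (hρ0 : ∀ x, 0 ≤ ρ x) {r : ℝ}
    (hs : ∀ x, x ∉ Metric.closedBall (0:EuclideanSpace ℝ (Fin N)) r → ρ x = 0)
    (hΦ : ∀ x, Φ x =
      ∫ y, (if N = 2 then Real.log ‖x - y‖ else -‖x - y‖ ^ (-((N:ℝ) - 2))) * ρ y) :
    ContDiff ℝ 1 Φ ∧ 0 ≤ ∫ x, ρ x * fderiv ℝ Φ x x := by
  haveI : Nonempty (Fin N) := ⟨⟨0, by omega⟩⟩
  by_cases h2 : N = 2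
  · simp only [if_pos h2] at hΦ
    refine ep_virial (G := fun z => Real.log ‖z‖) (a := fun _ => 1) (b := Real.log) (a' := 0)
      (b' := 1) (by fun_prop) ?_ (by simp) ?_ (hasDerivAt_const _ _) rfl ?_ zero_le_one hρ hρ0 hs
      hΦ (by simp)
    · refine ep_locint fun R => ?_
      have : (fun y : ℝ => y ^ (Module.finrank ℝ (EuclideanSpace ℝ (Fin N)) - 1) * Real.log y) =
          fun y => y * Real.log y := by
        simp [h2]
      rw [this]
      exact (Real.continuous_mul_log.continuousOn.integrableOn_Icc).mono_set Set.Ioc_subset_Icc_self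
    · intro s hs0 z hz
      rw [norm_smul, Real.norm_of_nonneg hs0.le, Real.log_mul hs0.ne' (norm_ne_zero_iff.2 hz)]
      ring
    · simpa using Real.hasDerivAt_log (one_ne_zero (α := ℝ))
  · simp only [if_neg h2] at hΦ
    have hN2 : (0:ℝ) ≤ (N:ℝ) - 2 := by
      have : (2:ℝ) ≤ N := by exact_mod_cast hN
      linarith
    refine ep_virial (G := fun z => -‖z‖ ^ (-((N:ℝ) - 2))) (a := fun s => s ^ (-((N:ℝ) - 2)))
      (b := fun _ => 0) (a' := -((N:ℝ) - 2))
      (b' := 0) (by fun_prop) ?_ (by simp) ?_ ?_ (by simp) (hasDerivAt_const _ _) le_rfl hρ hρ0 hs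
      hΦ ?_
    · refine ep_locint (g := fun y => -y ^ (-((N:ℝ) - 2))) fun R => ?_
      have : Set.EqOn (fun y : ℝ => -y) (fun y : ℝ => y ^ (Module.finrank ℝ (EuclideanSpace ℝ (Fin N)) - 1) *
          -y ^ (-((N:ℝ) - 2))) (Set.Ioc 0 R) := by
        intro y hy
        simp only [finrank_euclideanSpace, Fintype.card_fin]
        rw [mul_neg, ← Real.rpow_natCast, ← Real.rpow_add hy.1, Nat.cast_sub (by omega)]
        have : ((N:ℝ) - (1:ℕ)) + -((N:ℝ) - 2) = 1 := by push_cast; ring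
        rw [this, Real.rpow_one]
      refine IntegrableOn.congr_fun ?_ this measurableSet_Ioc
      exact (continuous_neg.continuousOn.integrableOn_Icc).mono_set Set.Ioc_subset_Icc_self
    · intro s hs0 z hz
      rw [norm_smul, Real.norm_of_nonneg hs0.le, Real.mul_rpow hs0.le (norm_nonneg _)]
      ring
    · simpa using Real.hasDerivAt_rpow_const (x := (1:ℝ)) (p := -((N:ℝ) - 2)) (Or.inl one_ne_zero)
    · refine mul_nonneg_of_nonpos_of_nonpos (by linarith) (integral_nonpos fun x => ?_)
      refine mul_nonpos_of_nonneg_of_nonpos (hρ0 x) ?_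
      rw [hΦ]
      refine integral_nonpos fun y => ?_
      refine mul_nonpos_of_nonpos_of_nonneg ?_ (hρ0 y)
      simp only [Left.neg_nonpos_iff]
      positivity


/-- **Stability for `N ≥ 2`, `γ > 1`, `K > 0`, with frictional damping `β > 0`.** For a
global classical solution with compact support of the `N`-dimensional Euler–Poisson
equations with repulsive forces and damping `β > 0`, with positive total mass `M` and
supports in a fixed bounded set `Ω` of positive finite volume, one has
`liminf_{t→∞} R(t)/t^{1/2} ≥ (2 N K M^{γ-1}/(β |Ω|^{γ-1}))^{1/2}`, where
`R(t) = max{|x| : x ∈ supp ρ(t,·)}`. -/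
theorem stability_euler_poisson_repulsive_damped
    (N : ℕ) (hN : 2 ≤ N) (γ K β : ℝ) (hγ : 1 < γ) (hK : 0 < K) (hβ : 0 < β)
    (ρ : ℝ → EuclideanSpace ℝ (Fin N) → ℝ)
    (u : ℝ → EuclideanSpace ℝ (Fin N) → EuclideanSpace ℝ (Fin N))
    (Φ : ℝ → EuclideanSpace ℝ (Fin N) → ℝ)
    (M : ℝ) (hM : 0 < M)
    (hρreg : ContDiffOn ℝ 1 (fun p : ℝ × EuclideanSpace ℝ (Fin N) => ρ p.1 p.2)
      (Set.Ici (0:ℝ) ×ˢ Set.univ))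
    (hureg : ContDiffOn ℝ 1 (fun p : ℝ × EuclideanSpace ℝ (Fin N) => u p.1 p.2)
      (Set.Ici (0:ℝ) ×ˢ Set.univ))
    (hρnonneg : ∀ t x, 0 ≤ ρ t x)
    (Ω : Set (EuclideanSpace ℝ (Fin N)))
    (hΩopen : IsOpen Ω) (hΩbdd : Bornology.IsBounded Ω)
    (hΩvol : 0 < volume Ω)
    (hsupp : ∀ t, 0 ≤ t →
      Function.support (ρ t) ⊆ Ω ∧ Function.support (u t) ⊆ Ω)
    -- the potential `Φ` is given by convolution with the Green function
    (hΦ : ∀ t x, Φ t x =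
      ∫ y, (if N = 2 then Real.log ‖x - y‖ else -‖x - y‖ ^ (-((N:ℝ) - 2))) * ρ t y)
    -- `M` is the (conserved) total mass
    (hmass_const : ∀ t, 0 ≤ t → (∫ x, ρ t x) = M)
    -- mass equation: `ρ_t + div(ρ u) = 0`
    (hmass : ∀ t, 0 ≤ t → ∀ x,
      deriv (fun s => ρ s x) t
        + ∑ i, fderiv ℝ (fun y => ρ t y * u t y i) x (EuclideanSpace.single i 1) = 0)
    -- momentum equation: `(ρ u)_t + div(ρ u ⊗ u) + ∇P + β ρ u = ρ ∇Φ`, `P = K ρ^γ`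
    (hmom : ∀ t, 0 ≤ t → ∀ x, ∀ i : Fin N,
      deriv (fun s => ρ s x * u s x i) t
        + ∑ j, fderiv ℝ (fun y => ρ t y * u t y i * u t y j) x (EuclideanSpace.single j 1)
        + fderiv ℝ (fun y => K * ρ t y ^ γ) x (EuclideanSpace.single i 1)
        + β * ρ t x * u t x i
      = ρ t x * fderiv ℝ (Φ t) x (EuclideanSpace.single i 1)) :
    Real.sqrt (2 * (N : ℝ) * K * M ^ (γ - 1) / (β * (volume Ω).toReal ^ (γ - 1))) ≤
      Filter.liminf
        (fun t => sSup ((fun x => ‖x‖) '' Function.support (ρ t)) / Real.sqrt t)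
        Filter.atTop := by
  exfalso
  obtain ⟨r, hr⟩ := hΩbdd.subset_closedBall 0
  have hVtop : volume Ω ≠ ⊤ := hΩbdd.measure_lt_top.ne
  have hV : 0 < (volume Ω).toReal := ENNReal.toReal_pos hΩvol.ne' hVtop
  have hρs : ∀ t, 0 ≤ t → ∀ x, x ∉ Metric.closedBall (0 : EuclideanSpace ℝ (Fin N)) r →
      ρ t x = 0 := by
    intro t ht x hx
    by_contra h
    exact hx (hr ((hsupp t ht).1 h))
  have hui : ∀ i, ContDiffOn ℝ 1 (fun p : ℝ × EuclideanSpace ℝ (Fin N) => u p.1 p.2 i)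
      (Set.Ici (0:ℝ) ×ˢ Set.univ) := by
    intro i
    exact (EuclideanSpace.proj (𝕜 := ℝ) i).contDiff.comp_contDiffOn hureg
  have hρt : ∀ t, 0 ≤ t → ContDiff ℝ 1 (ρ t) := by
    intro t ht
    rw [← contDiffOn_univ]
    exact hρreg.comp (f := fun x : EuclideanSpace ℝ (Fin N) => (t, x)) (s := Set.univ)
      (by fun_prop) (fun x _ => ⟨ht, Set.mem_univ _⟩)
  have hut : ∀ t, 0 ≤ t → ∀ i, ContDiff ℝ 1 (fun x => u t x i) := by
    intro t ht i
    rw [← contDiffOn_univ]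
    exact (hui i).comp (f := fun x : EuclideanSpace ℝ (Fin N) => (t, x)) (s := Set.univ)
      (by fun_prop) (fun x _ => ⟨ht, Set.mem_univ _⟩)
  have hsub : Set.Ioi (0:ℝ) ×ˢ (Set.univ : Set (EuclideanSpace ℝ (Fin N))) ⊆
      Set.Ici (0:ℝ) ×ˢ Set.univ := Set.prod_mono Set.Ioi_subset_Ici_self subset_rfl
  have hcoord : ∀ i : Fin N, ContDiff ℝ 1 (fun x : EuclideanSpace ℝ (Fin N) => x i) :=
    fun i => (EuclideanSpace.proj (𝕜 := ℝ) i).contDiff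
  have hnsq : ContDiff ℝ 1 (fun x : EuclideanSpace ℝ (Fin N) => ‖x‖ ^ 2) := contDiff_norm_sq ℝ
  have hdcoord : ∀ (i j : Fin N) (x : EuclideanSpace ℝ (Fin N)),
      fderiv ℝ (fun x : EuclideanSpace ℝ (Fin N) => x i) x (EuclideanSpace.single j 1) =
        if i = j then 1 else 0 := by
    intro i j x
    have : fderiv ℝ (fun x : EuclideanSpace ℝ (Fin N) => x i) x =
        EuclideanSpace.proj (𝕜 := ℝ) i := (EuclideanSpace.proj (𝕜 := ℝ) i).fderiv
    rw [this]
    simp [Pi.single_apply]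
  have hdnsq : ∀ (i : Fin N) (x : EuclideanSpace ℝ (Fin N)),
      fderiv ℝ (fun x : EuclideanSpace ℝ (Fin N) => ‖x‖ ^ 2) x (EuclideanSpace.single i 1) =
        2 * x i := by
    intro i x
    rw [fderiv_norm_sq_apply]
    simp [EuclideanSpace.inner_single_right]
  -- second inertia function
  set H : ℝ → ℝ := fun t => ∫ x, ‖x‖ ^ 2 * ρ t x with hHdef
  set q : Fin N → ℝ → ℝ := fun i t => ∫ x, x i * (ρ t x * u t x i) with hqdef
  have hH : ∀ t, 0 < t → HasDerivAt H (2 * ∑ i, q i t) t := by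
    intro t ht
    have h1 := ep_time (F := fun t x => ‖x‖ ^ 2 * ρ t x) (r := r)
      ((hnsq.comp contDiff_snd).contDiffOn.mul (hρreg.mono hsub))
      (fun t ht x hx => by simp [hρs t ht.le x hx]) ht
    have h2 : ∫ x, deriv (fun s => ‖x‖ ^ 2 * ρ s x) t = 2 * ∑ i, q i t := by
      have e : ∀ x, deriv (fun s => ‖x‖ ^ 2 * ρ s x) t = ∑ i, -(‖x‖ ^ 2 *
          fderiv ℝ (fun y => ρ t y * u t y i) x (EuclideanSpace.single i 1)) := by
        intro x
        rw [deriv_const_mul_field, eq_neg_of_add_eq_zero_left (hmass t ht.le x), mul_neg,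
          Finset.mul_sum, Finset.sum_neg_distrib]
      simp_rw [e]
      have hib := fun i => ep_ibp hnsq ((hρt t ht.le).mul (hut t ht.le i))
        (ep_hcs (hρs t ht.le)).mul_right (EuclideanSpace.single i 1)
      have hnib : ∀ i, Integrable (fun x => -(‖x‖ ^ 2 *
          fderiv ℝ (fun y => ρ t y * u t y i) x (EuclideanSpace.single i 1))) :=
        fun i => (hib i).1.neg
      rw [integral_finsetSum _ (fun i _ => (hnib i)), Finset.mul_sum]
      refine Finset.sum_congr rfl fun i _ => ?_
      rw [integral_neg]
      have := (hib i).2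
      rw [this, neg_neg, hqdef, ← integral_const_mul]
      refine integral_congr_ae (ae_of_all _ fun x => ?_)
      simp only [hdnsq]
      ring
    rw [h2] at h1
    exact h1
  have hPc : ∀ t, 0 ≤ t → ContDiff ℝ 1 (fun x => K * ρ t x ^ γ) := by
    intro t ht
    have : ContDiff ℝ ((1:ℕ):WithTop ℕ∞) (fun x : ℝ => x ^ γ) :=
      Real.contDiff_rpow_const_of_le (by simpa using hγ.le)
    exact contDiff_const.mul (this.comp (hρt t ht))
  have hPs : ∀ t, 0 ≤ t → HasCompactSupport (fun x => K * ρ t x ^ γ) := by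
    intro t ht
    refine ep_hcs (r := r) fun x hx => ?_
    rw [hρs t ht x hx, Real.zero_rpow (by linarith), mul_zero]
  have hΦv := fun t (ht : 0 ≤ t) => ep_virial_euclid N hN (hρt t ht) (hρnonneg t) (hρs t ht) (hΦ t)
  have hq : ∀ i t, 0 < t → HasDerivAt (q i)
      ((∫ x, ρ t x * u t x i * u t x i) + (∫ x, K * ρ t x ^ γ) - β * q i t
        + ∫ x, x i * (ρ t x * fderiv ℝ (Φ t) x (EuclideanSpace.single i 1))) t := by
    intro i t ht
    have h1 := ep_time (F := fun t x => x i * (ρ t x * u t x i)) (r := r)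
      (((hcoord i).comp contDiff_snd).contDiffOn.mul ((hρreg.mono hsub).mul ((hui i).mono hsub)))
      (fun t ht x hx => by simp [hρs t ht.le x hx]) ht
    convert h1 using 1
    have hcs := ep_hcs (hρs t ht.le)
    have e : ∀ x, deriv (fun s => x i * (ρ s x * u s x i)) t =
        (∑ j, -(x i * fderiv ℝ (fun y => ρ t y * u t y i * u t y j) x (EuclideanSpace.single j 1)))
        + -(x i * fderiv ℝ (fun y => K * ρ t y ^ γ) x (EuclideanSpace.single i 1))
        + -(β * (x i * (ρ t x * u t x i)))
        + x i * (ρ t x * fderiv ℝ (Φ t) x (EuclideanSpace.single i 1)) := by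
      intro x
      rw [deriv_const_mul_field, Finset.sum_neg_distrib, ← Finset.mul_sum, ← hmom t ht.le x i]
      ring
    simp_rw [e]
    have hib := fun j => ep_ibp (hcoord i) (((hρt t ht.le).mul (hut t ht.le i)).mul (hut t ht.le j))
        hcs.mul_right.mul_right (EuclideanSpace.single j 1)
    have hip := ep_ibp (hcoord i) (hPc t ht.le) (hPs t ht.le) (EuclideanSpace.single i 1)
    have hnib : ∀ j, Integrable (fun x => -(x i *
        fderiv ℝ (fun y => ρ t y * u t y i * u t y j) x (EuclideanSpace.single j 1))) :=
      fun j => (hib j).1.neg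
    have i1 := integrable_finsetSum Finset.univ (fun j _ => (hnib j))
    have i2 := hip.1.neg
    have i3 : Integrable (fun x => -(β * (x i * (ρ t x * u t x i)))) :=
      ((((hcoord i).continuous.mul ((hρt t ht.le).continuous.mul
        (hut t ht.le i).continuous)).integrable_of_hasCompactSupport
        hcs.mul_right.mul_left).const_mul β).neg
    have i4 : Integrable (fun x => x i * (ρ t x * fderiv ℝ (Φ t) x (EuclideanSpace.single i 1))) :=
      ((hcoord i).continuous.mul ((hρt t ht.le).continuous.mul
        (((hΦv t ht.le).1.continuous_fderiv (by simp)).clm_apply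
          continuous_const))).integrable_of_hasCompactSupport hcs.mul_right.mul_left
    have s1 : ∫ x, ∑ j, -(x i * fderiv ℝ (fun y => ρ t y * u t y i * u t y j) x
        (EuclideanSpace.single j 1)) = ∫ x, ρ t x * u t x i * u t x i := by
      rw [integral_finsetSum _ (fun j _ => (hnib j))]
      rw [Finset.sum_eq_single i]
      · rw [integral_neg]
        have := (hib i).2
        rw [this, neg_neg]
        simp [hdcoord]
      · intro j _ hj
        rw [integral_neg]
        have := (hib j).2
        rw [this, neg_neg]
        simp [hdcoord, hj.symm]
      · simp
    have s2 : ∫ x, -(x i * fderiv ℝ (fun y => K * ρ t y ^ γ) x (EuclideanSpace.single i 1)) =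
        ∫ x, K * ρ t x ^ γ := by
      rw [integral_neg, hip.2, neg_neg]
      simp [hdcoord]
    have s3 : ∫ x, -(β * (x i * (ρ t x * u t x i))) = -(β * q i t) := by
      rw [integral_neg, integral_const_mul]
    have t3 : ∫ x, ((∑ j, -(x i * fderiv ℝ (fun y => ρ t y * u t y i * u t y j) x
          (EuclideanSpace.single j 1)))
        + -(x i * fderiv ℝ (fun y => K * ρ t y ^ γ) x (EuclideanSpace.single i 1))
        + -(β * (x i * (ρ t x * u t x i)))
        + x i * (ρ t x * fderiv ℝ (Φ t) x (EuclideanSpace.single i 1))) = _ :=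
      integral_add ((i1.add i2).add i3) i4
    have t2 : ∫ x, ((∑ j, -(x i * fderiv ℝ (fun y => ρ t y * u t y i * u t y j) x
          (EuclideanSpace.single j 1)))
        + -(x i * fderiv ℝ (fun y => K * ρ t y ^ γ) x (EuclideanSpace.single i 1))
        + -(β * (x i * (ρ t x * u t x i)))) = _ :=
      integral_add (i1.add i2) i3
    have t1 : ∫ x, ((∑ j, -(x i * fderiv ℝ (fun y => ρ t y * u t y i * u t y j) x
          (EuclideanSpace.single j 1)))
        + -(x i * fderiv ℝ (fun y => K * ρ t y ^ γ) x (EuclideanSpace.single i 1))) = _ :=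
      integral_add i1 i2
    simp only [Pi.add_apply] at t1 t2 t3
    rw [t3]
    erw [t2, t1]
    erw [s1, s2, s3]
    ring
  have hvir : ∀ t, 0 < t →
      0 ≤ ∑ i, ∫ x, x i * (ρ t x * fderiv ℝ (Φ t) x (EuclideanSpace.single i 1)) := by
    intro t ht
    have i4 : ∀ i, Integrable
        (fun x => x i * (ρ t x * fderiv ℝ (Φ t) x (EuclideanSpace.single i 1))) := fun i =>
      ((hcoord i).continuous.mul ((hρt t ht.le).continuous.mul
        (((hΦv t ht.le).1.continuous_fderiv (by simp)).clm_apply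
          continuous_const))).integrable_of_hasCompactSupport
            (ep_hcs (hρs t ht.le)).mul_right.mul_left
    rw [← integral_finsetSum _ (fun i _ => i4 i)]
    refine le_of_le_of_eq (hΦv t ht.le).2 (integral_congr_ae (ae_of_all _ fun x => ?_))
    have hx : x = ∑ i, x i • EuclideanSpace.single i (1:ℝ) := by
      have := (EuclideanSpace.basisFun (Fin N) ℝ).sum_repr x
      simpa using this.symm
    have : fderiv ℝ (Φ t) x x = ∑ i, x i * fderiv ℝ (Φ t) x (EuclideanSpace.single i 1) := by
      have key := congrArg (fderiv ℝ (Φ t) x) hx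
      rw [map_sum] at key
      simpa only [map_smul, smul_eq_mul] using key
    simp only [this, Finset.mul_sum]
    refine Finset.sum_congr rfl fun i _ => ?_
    ring
  set c0 := (M / (volume Ω).toReal) ^ γ * (volume Ω).toReal with hc0
  have hc0pos : 0 < c0 := by positivity
  have hjen : ∀ t, 0 < t → K * c0 ≤ ∫ x, K * ρ t x ^ γ := by
    intro t ht
    have hint : Integrable (fun x => ρ t x ^ γ) := by
      have := (((hPc t ht.le).continuous.integrable_of_hasCompactSupport (μ := volume)
        (hPs t ht.le)).const_mul K⁻¹)
      simpa [← mul_assoc, inv_mul_cancel₀ hK.ne'] using this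
    rw [integral_const_mul]
    refine mul_le_mul_of_nonneg_left ?_ hK.le
    exact ep_jensen hγ hM hΩopen.measurableSet hV (hρnonneg t) (hsupp t ht.le).1
      ((hρt t ht.le).continuous.integrable_of_hasCompactSupport (ep_hcs (hρs t ht.le)))
      hint (hmass_const t ht.le)
  have hNpos : (0:ℝ) < N := by
    have : 0 < N := by omega
    exact_mod_cast this
  refine ep_ode (H := H) (Q := fun t => 2 * ∑ i, q i t) (β := β) (c := 2 * (N * (K * c0)))
    (B := r ^ 2 * M) hβ (by positivity) hH
    (fun t ht => (HasDerivAt.fun_sum fun i _ => hq i t ht).const_mul 2) ?_ ?_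
  · intro t ht
    have e1 : (N:ℝ) * (K * c0) ≤ ∑ i : Fin N, ∫ x, K * ρ t x ^ γ := by
      rw [Finset.sum_const, Finset.card_univ, Fintype.card_fin, nsmul_eq_mul]
      exact mul_le_mul_of_nonneg_left (hjen t ht) hNpos.le
    have e2 : 0 ≤ ∑ i, ∫ x, ρ t x * u t x i * u t x i := by
      refine Finset.sum_nonneg fun i _ => integral_nonneg fun x => ?_
      simp only [Pi.zero_apply, mul_assoc]
      exact mul_nonneg (hρnonneg t x) (mul_self_nonneg _)
    have e3 := hvir t ht
    simp only [Finset.sum_add_distrib, Finset.sum_sub_distrib, ← Finset.mul_sum]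
    linarith
  · intro t ht
    have hi := (hρt t ht.le).continuous.integrable_of_hasCompactSupport (μ := volume)
      (ep_hcs (hρs t ht.le))
    rw [← hmass_const t ht.le, ← integral_const_mul]
    refine integral_mono ?_ (hi.const_mul _) fun x => ?_
    · exact (hnsq.continuous.mul (hρt t ht.le).continuous).integrable_of_hasCompactSupport
        (ep_hcs (hρs t ht.le)).mul_left
    · by_cases hx : x ∈ Metric.closedBall (0 : EuclideanSpace ℝ (Fin N)) r
      · have : ‖x‖ ≤ r := by simpa using hx
        exact mul_le_mul_of_nonneg_right (pow_le_pow_left₀ (norm_nonneg _) this 2) (hρnonneg t x)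
      · simp [hρs t ht.le x hx]
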